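/- arXiv:2507.05936 — 2 statements merged into one kernel-verified Lean document; each statement's English description precedes it below -/
import Mathlib

section
/- Let Φ(ξ) = ∑_{j=1}^d (2 − 2cos ξ_j), fix 0 < s < 1 and fix h ∈ ℤ^d. Then lim_{t→∞} t^{d/(2s)} · (2π)^{−d} ∫_{[−π,π]^d} e^{−tΦ(ξ)^s} e^{i h·ξ} dξ = (2π)^{−d} ∫_{ℝ^d} e^{−|η|^{2s}} dη = π^{−d/2} Γ(d/(2s)) / (s 2^d Γ(d/2)). -/
theorem EuclideanSpace.integral_exp_neg_norm_rpow {ι : Type*} [Fintype ι] [Nonempty ι] {p : ℝ}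
    (hp : 0 < p) :
    ∫ x : EuclideanSpace ℝ ι, Real.exp (-‖x‖ ^ p) =
      √Real.pi ^ Fintype.card ι / Real.Gamma (Fintype.card ι / 2 + 1) *
        Real.Gamma (Fintype.card ι / p + 1) := by
  have hΓp : 0 < Real.Gamma (Fintype.card ι / p + 1) := Real.Gamma_pos_of_pos (by positivity)
  have hΓ2 : 0 < Real.Gamma ((Fintype.card ι : ℝ) / 2 + 1) :=
    Real.Gamma_pos_of_pos (by positivity)
  have hvol := MeasureTheory.measure_unitBall_eq_integral_div_gamma
    (MeasureTheory.volume : MeasureTheory.Measure (EuclideanSpace ℝ ι)) hp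
  rw [EuclideanSpace.volume_ball, ENNReal.ofReal_one, one_pow, one_mul,
    ENNReal.ofReal_eq_ofReal_iff (by positivity)
      (div_nonneg (MeasureTheory.integral_nonneg fun _ => (Real.exp_pos _).le)
        (by simpa using hΓp.le)), finrank_euclideanSpace, eq_div_iff hΓp.ne'] at hvol
  exact hvol.symm

theorem two_pi_rpow_neg_mul_integral_exp_neg_norm_rpow {d : ℕ} (hd : 1 ≤ d) {s : ℝ}
    (hs : 0 < s) :
    (2 * Real.pi) ^ (-(d : ℝ)) *
        (∫ η : EuclideanSpace ℝ (Fin d), Real.exp (-‖η‖ ^ (2 * s))) =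
      Real.pi ^ (-(d : ℝ) / 2) * Real.Gamma ((d : ℝ) / (2 * s)) /
        (s * 2 ^ d * Real.Gamma ((d : ℝ) / 2)) := by
  have : Nonempty (Fin d) := ⟨⟨0, hd⟩⟩
  have hd' : (0 : ℝ) < d := by exact_mod_cast hd
  have hπ := Real.pi_pos
  have hsqrt : 0 < √Real.pi := Real.sqrt_pos.2 hπ
  have hΓ : 0 < Real.Gamma ((d : ℝ) / 2) := Real.Gamma_pos_of_pos (by positivity)
  have hpow : Real.pi ^ (-(d : ℝ) / 2) = (√Real.pi ^ d)⁻¹ := by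
    rw [neg_div, Real.rpow_neg hπ.le, Real.sqrt_eq_rpow, ← Real.rpow_natCast,
      ← Real.rpow_mul hπ.le]
    ring_nf
  have hpow' : (2 * Real.pi) ^ (-(d : ℝ)) = (2 ^ d * (√Real.pi ^ d) ^ 2)⁻¹ := by
    rw [Real.rpow_neg (by positivity), Real.rpow_natCast, mul_pow, ← pow_mul, mul_comm d 2,
      pow_mul, Real.sq_sqrt hπ.le]
  rw [EuclideanSpace.integral_exp_neg_norm_rpow (by positivity), Fintype.card_fin, hpow, hpow',
    Real.Gamma_add_one (by positivity), Real.Gamma_add_one (by positivity)]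
  field_simp

theorem integral_exp_neg_sum_sq_rpow {ι : Type*} [Fintype ι] (s : ℝ) :
    ∫ η : ι → ℝ, Real.exp (-(∑ j, η j ^ 2) ^ s) =
      ∫ η : EuclideanSpace ℝ ι, Real.exp (-‖η‖ ^ (2 * s)) := by
  rw [← (PiLp.volume_preserving_toLp ι).integral_comp
    (MeasurableEquiv.toLp 2 (ι → ℝ)).measurableEmbedding]
  refine MeasureTheory.integral_congr_ae (.of_forall fun η => ?_)
  simp only [Real.rpow_mul (norm_nonneg _), Real.rpow_two, EuclideanSpace.real_norm_sq_eq]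

theorem integrable_exp_neg_sum_sq_rpow {ι : Type*} [Fintype ι] [Nonempty ι] {s : ℝ}
    (hs : 0 < s) :
    MeasureTheory.Integrable fun η : ι → ℝ => Real.exp (-(∑ j, η j ^ 2) ^ s) := by
  refine MeasureTheory.Integrable.of_integral_ne_zero ?_
  rw [integral_exp_neg_sum_sq_rpow, EuclideanSpace.integral_exp_neg_norm_rpow (by positivity)]
  have h₁ : 0 < Real.Gamma (Fintype.card ι / (2 * s) + 1) := Real.Gamma_pos_of_pos (by positivity)
  have h₂ : 0 < Real.Gamma ((Fintype.card ι : ℝ) / 2 + 1) :=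
    Real.Gamma_pos_of_pos (by positivity)
  have := Real.sqrt_pos.2 Real.pi_pos
  positivity

/-- The symbol of the discrete Laplacian on `ℤ^ι`. -/
noncomputable def latticeSymbol {ι : Type*} [Fintype ι] (ξ : ι → ℝ) : ℝ :=
  ∑ j, (2 - 2 * Real.cos (ξ j))

theorem continuous_latticeSymbol {ι : Type*} [Fintype ι] :
    Continuous (latticeSymbol : (ι → ℝ) → ℝ) := by
  unfold latticeSymbol
  fun_prop

theorem latticeSymbol_nonneg {ι : Type*} [Fintype ι] (ξ : ι → ℝ) : 0 ≤ latticeSymbol ξ :=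
  Finset.sum_nonneg fun j _ => by linarith [Real.cos_le_one (ξ j)]

theorem sum_sq_le_latticeSymbol {ι : Type*} [Fintype ι] {ξ : ι → ℝ}
    (hξ : ξ ∈ Set.univ.pi fun _ : ι => Set.Icc (-Real.pi) Real.pi) :
    ∑ j, (2 / Real.pi * ξ j) ^ 2 ≤ latticeSymbol ξ := by
  refine Finset.sum_le_sum fun j _ => ?_
  have := Real.cos_le_one_sub_mul_cos_sq (abs_le.2 (hξ j trivial))
  have h : (2 / Real.pi * ξ j) ^ 2 = 2 * (2 / Real.pi ^ 2 * ξ j ^ 2) := by ring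
  linarith

theorem sq_mul_two_sub_two_mul_cos {r : ℝ} (hr : r ≠ 0) (x : ℝ) :
    r ^ 2 * (2 - 2 * Real.cos (r⁻¹ * x)) = (x * Real.sinc (r⁻¹ * x / 2)) ^ 2 := by
  rcases eq_or_ne x 0 with rfl | hx
  · simp
  · have hcos : Real.cos (r⁻¹ * x) = 1 - 2 * Real.sin (r⁻¹ * x / 2) ^ 2 := by
      rw [← Real.cos_sq_add_sin_sq (r⁻¹ * x / 2), show r⁻¹ * x = 2 * (r⁻¹ * x / 2) by ring,
        Real.cos_two_mul', show 2 * (r⁻¹ * x / 2) / 2 = r⁻¹ * x / 2 by ring]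
      ring
    rw [hcos, Real.sinc_of_ne_zero (by positivity)]
    field_simp
    ring

theorem tendsto_sq_mul_latticeSymbol {ι : Type*} [Fintype ι] (η : ι → ℝ) :
    Filter.Tendsto (fun r : ℝ => r ^ 2 * latticeSymbol (r⁻¹ • η)) Filter.atTop
      (nhds (∑ j, η j ^ 2)) := by
  have hlim : Filter.Tendsto (fun r : ℝ => ∑ j, (η j * Real.sinc (r⁻¹ * η j / 2)) ^ 2)
      Filter.atTop (nhds (∑ j, η j ^ 2)) := by
    have hcont : Continuous fun u : ℝ => ∑ j, (η j * Real.sinc (u * η j / 2)) ^ 2 := by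
      have := Real.continuous_sinc
      fun_prop
    simpa [Function.comp_def] using (hcont.tendsto 0).comp tendsto_inv_atTop_zero
  refine hlim.congr' ?_
  filter_upwards [Filter.eventually_ne_atTop 0] with r hr
  simp only [latticeSymbol, Finset.mul_sum, Pi.smul_apply, smul_eq_mul,
    sq_mul_two_sub_two_mul_cos hr]

/-- The integrand of the fractional heat kernel on `ℤ^ι` at time `r ^ (2 * s)`, cut off outside
the Brillouin zone. -/
noncomputable def latticeHeatIntegrand {ι : Type*} [Fintype ι] (s : ℝ) (h : ι → ℤ) (r : ℝ) :
    (ι → ℝ) → ℂ :=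
  (Set.univ.pi fun _ : ι => Set.Icc (-Real.pi) Real.pi).indicator fun ξ =>
    Complex.exp (-((r ^ (2 * s) : ℝ) : ℂ) * ((latticeSymbol ξ ^ s : ℝ) : ℂ)) *
      Complex.exp (Complex.I * ((∑ j, (h j : ℝ) * ξ j : ℝ) : ℂ))

theorem rpow_two_mul_mul_rpow {r : ℝ} (hr : 0 ≤ r) (s : ℝ) {a : ℝ} (ha : 0 ≤ a) :
    r ^ (2 * s) * a ^ s = (r ^ 2 * a) ^ s := by
  rw [Real.mul_rpow (by positivity) ha, Real.rpow_mul hr, Real.rpow_two]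

theorem norm_latticeHeatIntegrand_le {ι : Type*} [Fintype ι] {s : ℝ} (hs : 0 ≤ s) (h : ι → ℤ)
    {r : ℝ} (hr : 0 < r) (η : ι → ℝ) :
    ‖latticeHeatIntegrand s h r (r⁻¹ • η)‖ ≤
      Real.exp (-(∑ j, ((2 / Real.pi) • η) j ^ 2) ^ s) := by
  unfold latticeHeatIntegrand
  by_cases hη : r⁻¹ • η ∈ Set.univ.pi fun _ : ι => Set.Icc (-Real.pi) Real.pi
  · rw [Set.indicator_of_mem hη, norm_mul, mul_comm Complex.I, Complex.norm_exp_ofReal_mul_I,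
      mul_one, ← Complex.ofReal_neg, ← Complex.ofReal_mul, Complex.norm_exp_ofReal,
      Real.exp_le_exp, neg_mul, neg_le_neg_iff,
      rpow_two_mul_mul_rpow hr.le s (latticeSymbol_nonneg _)]
    refine Real.rpow_le_rpow (by positivity) ?_ hs
    calc ∑ j, ((2 / Real.pi) • η) j ^ 2
        = r ^ 2 * ∑ j, (2 / Real.pi * (r⁻¹ • η) j) ^ 2 := by
          rw [Finset.mul_sum]
          refine Finset.sum_congr rfl fun j _ => ?_
          simp only [Pi.smul_apply, smul_eq_mul]
          field_simp
      _ ≤ r ^ 2 * latticeSymbol (r⁻¹ • η) := by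
          gcongr
          exact sum_sq_le_latticeSymbol hη
  · rw [Set.indicator_of_notMem hη, norm_zero]
    positivity

theorem tendsto_latticeHeatIntegrand {ι : Type*} [Fintype ι] {s : ℝ} (hs : 0 ≤ s) (h : ι → ℤ)
    (η : ι → ℝ) :
    Filter.Tendsto (fun r : ℝ => latticeHeatIntegrand s h r (r⁻¹ • η)) Filter.atTop
      (nhds ((Real.exp (-(∑ j, η j ^ 2) ^ s) : ℝ) : ℂ)) := by
  have hzero : Filter.Tendsto (fun r : ℝ => r⁻¹ • η) Filter.atTop (nhds 0) := by
    simpa using (tendsto_inv_atTop_zero (𝕜 := ℝ)).smul_const η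
  have hmem : ∀ᶠ r : ℝ in Filter.atTop,
      r⁻¹ • η ∈ Set.univ.pi fun _ : ι => Set.Icc (-Real.pi) Real.pi :=
    hzero.eventually_mem <| set_pi_mem_nhds Set.finite_univ fun _ _ =>
      Icc_mem_nhds (neg_lt_zero.2 Real.pi_pos) Real.pi_pos
  have hheat : Filter.Tendsto
      (fun r : ℝ => ((Real.exp (-(r ^ 2 * latticeSymbol (r⁻¹ • η)) ^ s) : ℝ) : ℂ))
      Filter.atTop (nhds ((Real.exp (-(∑ j, η j ^ 2) ^ s) : ℝ) : ℂ)) :=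
    (Complex.continuous_ofReal.tendsto _).comp <| (Real.continuous_exp.tendsto _).comp <|
      ((tendsto_sq_mul_latticeSymbol η).rpow_const (.inr hs)).neg
  have hphase : Filter.Tendsto
      (fun r : ℝ => Complex.exp (Complex.I * ((∑ j, (h j : ℝ) * (r⁻¹ • η) j : ℝ) : ℂ)))
      Filter.atTop (nhds 1) := by
    have hcont : Continuous fun ξ : ι → ℝ =>
        Complex.exp (Complex.I * ((∑ j, (h j : ℝ) * ξ j : ℝ) : ℂ)) := by fun_prop
    simpa [Function.comp_def] using (hcont.tendsto 0).comp hzero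
  have hlim := hheat.mul hphase
  rw [mul_one] at hlim
  refine hlim.congr' ?_
  filter_upwards [hmem, Filter.eventually_ge_atTop 0] with r hr hr0
  rw [latticeHeatIntegrand, Set.indicator_of_mem hr,
    ← rpow_two_mul_mul_rpow hr0 s (latticeSymbol_nonneg _)]
  push_cast
  rw [neg_mul]

theorem measurable_latticeHeatIntegrand {ι : Type*} [Fintype ι] (s : ℝ) (h : ι → ℤ) (r : ℝ) :
    Measurable (latticeHeatIntegrand s h r) := by
  have := (continuous_latticeSymbol (ι := ι)).measurable
  unfold latticeHeatIntegrand
  refine Measurable.indicator ?_ (MeasurableSet.univ_pi fun _ => measurableSet_Icc)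
  fun_prop

theorem tendsto_pow_smul_integral_latticeHeatIntegrand {ι : Type*} [Fintype ι] [Nonempty ι]
    {s : ℝ} (hs : 0 < s) (h : ι → ℤ) :
    Filter.Tendsto
      (fun r : ℝ => r ^ Fintype.card ι • ∫ ξ, latticeHeatIntegrand s h r ξ) Filter.atTop
      (nhds ((∫ η : EuclideanSpace ℝ ι, Real.exp (-‖η‖ ^ (2 * s)) : ℝ) : ℂ)) := by
  rw [← integral_exp_neg_sum_sq_rpow, ← integral_complex_ofReal]
  have hlim : Filter.Tendsto
      (fun r : ℝ => ∫ η, latticeHeatIntegrand s h r (r⁻¹ • η)) Filter.atTop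
      (nhds (∫ η : ι → ℝ, ((Real.exp (-(∑ j, η j ^ 2) ^ s) : ℝ) : ℂ))) := by
    refine MeasureTheory.tendsto_integral_filter_of_dominated_convergence
      (fun η => Real.exp (-(∑ j, ((2 / Real.pi) • η) j ^ 2) ^ s)) ?_ ?_
      ((integrable_exp_neg_sum_sq_rpow hs).comp_smul (by positivity))
      (.of_forall (tendsto_latticeHeatIntegrand hs.le h))
    · exact .of_forall fun r => ((measurable_latticeHeatIntegrand s h r).comp
        (measurable_const_smul r⁻¹)).aestronglyMeasurable
    · filter_upwards [Filter.eventually_gt_atTop 0] with r hr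
      exact .of_forall (norm_latticeHeatIntegrand_le hs.le h hr)
  refine hlim.congr' ?_
  filter_upwards [Filter.eventually_ge_atTop 0] with r hr
  rw [MeasureTheory.Measure.integral_comp_inv_smul_of_nonneg _ _ hr,
    Module.finrank_fintype_fun_eq_card]

theorem stmt16 (d : ℕ) (hd : 1 ≤ d) (s : ℝ) (hs : s ∈ Set.Ioo (0:ℝ) 1)
    (h : Fin d → ℤ) :
    Filter.Tendsto
      (fun t : ℝ => (t ^ ((d:ℝ)/(2*s)) * (2*Real.pi) ^ (-(d:ℝ))) •
        ∫ ξ in Set.univ.pi fun _ : Fin d => Set.Icc (-Real.pi) Real.pi,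
          Complex.exp (-(t:ℂ) * (((∑ j, (2 - 2 * Real.cos (ξ j))) ^ s : ℝ) : ℂ)) *
            Complex.exp (Complex.I * (((∑ j, (h j : ℝ) * ξ j : ℝ)) : ℂ)))
      Filter.atTop
      (nhds (((Real.pi ^ (-(d:ℝ)/2) * Real.Gamma ((d:ℝ)/(2*s)) /
        (s * 2^d * Real.Gamma ((d:ℝ)/2)) : ℝ)) : ℂ)) ∧
    (2*Real.pi) ^ (-(d:ℝ)) *
        (∫ η : EuclideanSpace ℝ (Fin d), Real.exp (-‖η‖ ^ (2*s))) =
      Real.pi ^ (-(d:ℝ)/2) * Real.Gamma ((d:ℝ)/(2*s)) /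
        (s * 2^d * Real.Gamma ((d:ℝ)/2)) := by
  obtain ⟨hs0, -⟩ := hs
  have hconst := two_pi_rpow_neg_mul_integral_exp_neg_norm_rpow hd hs0
  refine ⟨?_, hconst⟩
  have : Nonempty (Fin d) := ⟨⟨0, hd⟩⟩
  have hlim := ((tendsto_pow_smul_integral_latticeHeatIntegrand hs0 h).comp
    (tendsto_rpow_atTop (y := (2 * s)⁻¹) (by positivity))).const_smul
      ((2 * Real.pi) ^ (-(d : ℝ)))
  rw [← hconst, Complex.ofReal_mul, ← Complex.real_smul]
  refine hlim.congr' ?_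
  filter_upwards [Filter.eventually_ge_atTop 0] with t ht
  have hpow : (t ^ (2 * s)⁻¹) ^ d = t ^ ((d : ℝ) / (2 * s)) := by
    rw [← Real.rpow_natCast, ← Real.rpow_mul ht, inv_mul_eq_div]
  rw [Function.comp_apply, Fintype.card_fin, hpow, smul_smul, mul_comm]
  simp only [latticeHeatIntegrand, Real.rpow_inv_rpow ht (by positivity : 2 * s ≠ 0)]
  rw [MeasureTheory.integral_indicator (MeasurableSet.univ_pi fun _ => measurableSet_Icc)]
  rfl
end

section
/- Fix d ≥ 1 and a fixed pair x ≠ y in ℤ^d, and let Φ(ξ) = ∑_{j=1}^d (2 − 2cos ξ_j), p_log(t) = (2π)^{−d} ∫_{[−π,π]^d} Φ(ξ)^{−t} e^{i(x−y)·ξ} dξ for 0 ≤ t < d/2. Then lim_{t → (d/2)⁻} (d − 2t) · (2π)^d · p_log(t) = |𝕊^{d−1}|, the surface measure of the unit sphere in ℝ^d. -/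
open MeasureTheory Set Filter Topology

/-- The squared Euclidean norm on `Fin d → ℝ`. -/
noncomputable def sumSq {d : ℕ} (ξ : Fin d → ℝ) : ℝ := ∑ j, ξ j ^ 2

/-- The Fourier symbol of the negative lattice Laplacian. -/
noncomputable def laplaceSymbol {d : ℕ} (ξ : Fin d → ℝ) : ℝ := ∑ j, (2 - 2 * Real.cos (ξ j))

/-- The surface measure of the unit sphere in `ℝ^d`. -/
noncomputable def sphereArea (d : ℕ) : ℝ := 2 * Real.pi ^ ((d:ℝ)/2) / Real.Gamma ((d:ℝ)/2)

/-- The Brillouin zone with the origin removed. -/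
def puncturedTorus (d : ℕ) : Set (Fin d → ℝ) :=
  (univ.pi fun _ => Icc (-Real.pi) Real.pi) \ {0}

/-- The open Euclidean unit ball with the origin removed. -/
def puncturedBall (d : ℕ) : Set (Fin d → ℝ) := {ξ | sumSq ξ < 1} \ {0}

section

variable {d : ℕ}

lemma continuous_sumSq : Continuous (sumSq : (Fin d → ℝ) → ℝ) := by
  unfold sumSq; fun_prop

lemma continuous_laplaceSymbol : Continuous (laplaceSymbol : (Fin d → ℝ) → ℝ) := by
  unfold laplaceSymbol; fun_prop

lemma sphereArea_pos (hd : 1 ≤ d) : 0 < sphereArea d := by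
  have : (0:ℝ) < d := by exact_mod_cast hd
  have := Real.Gamma_pos_of_pos (s := (d:ℝ)/2) (by positivity)
  unfold sphereArea
  have := Real.pi_pos
  positivity

lemma sq_le_sumSq (ξ : Fin d → ℝ) (j : Fin d) : ξ j ^ 2 ≤ sumSq ξ :=
  Finset.single_le_sum (f := fun j => ξ j ^ 2) (fun _ _ => sq_nonneg _) (Finset.mem_univ j)

lemma sumSq_pos {ξ : Fin d → ℝ} (h : ξ ≠ 0) : 0 < sumSq ξ := by
  obtain ⟨j, hj⟩ := Function.ne_iff.mp h
  exact (pow_pos (abs_pos.mpr hj) 2).trans_le (by simpa using sq_le_sumSq ξ j)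

lemma laplaceSymbol_le_sumSq (ξ : Fin d → ℝ) : laplaceSymbol ξ ≤ sumSq ξ :=
  Finset.sum_le_sum fun j _ => by linarith [Real.one_sub_sq_div_two_le_cos (x := ξ j)]

lemma mul_sumSq_le_laplaceSymbol {ξ : Fin d → ℝ}
    (h : ξ ∈ univ.pi fun _ : Fin d => Icc (-Real.pi) Real.pi) :
    4 / Real.pi ^ 2 * sumSq ξ ≤ laplaceSymbol ξ := by
  unfold sumSq laplaceSymbol
  rw [Finset.mul_sum]
  refine Finset.sum_le_sum fun j _ => ?_
  have := Real.cos_le_one_sub_mul_cos_sq (abs_le.mpr (h j (mem_univ j)))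
  linarith [show 4 / Real.pi ^ 2 * ξ j ^ 2 = 2 * (2 / Real.pi ^ 2 * ξ j ^ 2) by ring]

lemma sumSq_mul_one_sub_le_laplaceSymbol {ξ : Fin d → ℝ} (h : sumSq ξ < 1) :
    sumSq ξ * (1 - sumSq ξ) ≤ laplaceSymbol ξ := by
  conv_lhs => enter [1]; unfold sumSq
  unfold laplaceSymbol
  rw [Finset.sum_mul]
  refine Finset.sum_le_sum fun j _ => ?_
  have h1 := sq_le_sumSq ξ j
  have h2 : |ξ j| ≤ 1 := (sq_le_one_iff_abs_le_one _).mp (h1.trans h.le)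
  have h3 := (abs_le.mp (Real.cos_bound h2)).2
  have h4 : |ξ j| ^ 4 = ξ j ^ 2 * ξ j ^ 2 := by
    rw [show |ξ j| ^ 4 = (|ξ j| ^ 2) * (|ξ j| ^ 2) by ring, sq_abs]
  nlinarith [mul_le_mul_of_nonneg_left h1 (sq_nonneg (ξ j)), sq_nonneg (ξ j ^ 2)]

lemma puncturedBall_subset : puncturedBall d ⊆ puncturedTorus d := by
  refine sdiff_subset_sdiff_left fun ξ hξ j _ => abs_le.mp ?_
  have := (sq_le_one_iff_abs_le_one _).mp ((sq_le_sumSq ξ j).trans (le_of_lt hξ))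
  linarith [Real.pi_gt_three]

lemma isOpen_sumSq_lt_one : IsOpen {ξ : Fin d → ℝ | sumSq ξ < 1} :=
  isOpen_lt continuous_sumSq continuous_const

lemma measurableSet_puncturedBall : MeasurableSet (puncturedBall d) :=
  isOpen_sumSq_lt_one.measurableSet.diff (measurableSet_singleton 0)

lemma measurableSet_puncturedTorus : MeasurableSet (puncturedTorus d) :=
  (MeasurableSet.univ_pi fun _ => measurableSet_Icc).diff (measurableSet_singleton 0)

lemma puncturedBall_mem : puncturedBall d ∈ 𝓝[puncturedTorus d] 0 := by
  have h : {ξ : Fin d → ℝ | sumSq ξ < 1} ∈ 𝓝 0 :=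
    isOpen_sumSq_lt_one.mem_nhds (by simp [sumSq])
  filter_upwards [mem_nhdsWithin_of_mem_nhds h, self_mem_nhdsWithin] with ξ h1 h2
  exact ⟨h1, h2.2⟩

lemma volume_puncturedTorus_ne_top : volume (puncturedTorus d) ≠ ⊤ :=
  ((measure_mono sdiff_subset).trans_lt
    (isCompact_univ_pi fun _ => isCompact_Icc).measure_lt_top).ne

lemma volume_puncturedBall_ne_top : volume (puncturedBall d) ≠ ⊤ :=
  ((measure_mono puncturedBall_subset).trans_lt volume_puncturedTorus_ne_top.lt_top).ne

lemma exists_pos_le_sumSq {u : Set (Fin d → ℝ)} (hu : IsOpen u) (h0 : 0 ∈ u) :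
    ∃ c > 0, ∀ ξ ∉ u, c ≤ sumSq ξ := by
  obtain ⟨ε, hε, h⟩ := Metric.isOpen_iff.mp hu 0 h0
  refine ⟨ε ^ 2, by positivity, fun ξ hξ => ?_⟩
  by_contra! hc
  refine hξ (h ?_)
  rw [mem_ball_zero_iff, pi_norm_lt_iff hε]
  intro j
  exact lt_of_pow_lt_pow_left₀ 2 hε.le (by simpa using (sq_le_sumSq ξ j).trans_lt hc)

lemma sub_two_mul_pos {t : ℝ} (ht : t < (d:ℝ)/2) : 0 < (d:ℝ) - 2 * t := by linarith

lemma eventually_pos_lt (hd : 1 ≤ d) :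
    ∀ᶠ t : ℝ in 𝓝[<] ((d:ℝ)/2), 0 < t ∧ t < (d:ℝ)/2 := by
  have : (0:ℝ) < d := by exact_mod_cast hd
  exact Ioo_mem_nhdsLT (by positivity)

lemma tendstoUniformlyOn_rpow_neg {α : Type*} (hd : 1 ≤ d) {h : α → ℝ} {A : Set α} {c : ℝ}
    (hc : 0 < c) (hA : ∀ x ∈ A, c ≤ h x) :
    TendstoUniformlyOn (fun (t : ℝ) x => ((d:ℝ) - 2 * t) / sphereArea d * h x ^ (-t)) 0
      (𝓝[<] ((d:ℝ)/2)) A := by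
  have hS := sphereArea_pos hd
  have hlim : Tendsto (fun t : ℝ => ((d:ℝ) - 2 * t) / sphereArea d * c ^ (-t))
      (𝓝[<] ((d:ℝ)/2)) (𝓝 0) := by
    have : Continuous fun t : ℝ => ((d:ℝ) - 2 * t) / sphereArea d * c ^ (-t) := by
      have := hc.ne'
      fun_prop (disch := assumption)
    have h2 := this.tendsto ((d:ℝ)/2)
    rw [show (d:ℝ) - 2 * ((d:ℝ)/2) = 0 by ring, zero_div, zero_mul] at h2
    exact h2.mono_left nhdsWithin_le_nhds
  rw [Metric.tendstoUniformlyOn_iff]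
  intro ε hε
  filter_upwards [hlim.eventually_lt_const hε, eventually_pos_lt hd] with t h1 ⟨h2, h3⟩ x hx
  have h4 := sub_two_mul_pos h3
  have h5 : 0 < h x := hc.trans_le (hA x hx)
  rw [Pi.zero_apply, dist_comm, Real.dist_0_eq_abs, abs_of_nonneg (by positivity)]
  refine lt_of_le_of_lt ?_ h1
  gcongr ?_ * ?_
  exact Real.rpow_le_rpow_of_nonpos hc (hA x hx) (by linarith)

lemma setIntegral_rpow_sumSq (hd : 1 ≤ d) {t : ℝ} (ht : t < (d:ℝ)/2) :
    ∫ ξ in puncturedBall d, ((d:ℝ) - 2 * t) / sphereArea d * sumSq ξ ^ (-t) = 1 := by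
  have : Nonempty (Fin d) := ⟨⟨0, hd⟩⟩
  have hS := sphereArea_pos hd
  have ht' := sub_two_mul_pos ht
  have hd0 : (0:ℝ) < d := by exact_mod_cast hd
  have hnull : puncturedBall d =ᵐ[volume] {ξ | sumSq ξ < 1} :=
    sdiff_null_ae_eq_self (measure_singleton 0)
  rw [integral_const_mul, setIntegral_congr_set hnull,
    ← integral_indicator isOpen_sumSq_lt_one.measurableSet,
    ← (PiLp.volume_preserving_ofLp (Fin d)).integral_comp
      (MeasurableEquiv.toLp 2 (Fin d → ℝ)).symm.measurableEmbedding]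
  have hsq : ∀ x : EuclideanSpace ℝ (Fin d), sumSq (WithLp.ofLp x) = ‖x‖ ^ 2 := by
    intro x; simp [sumSq, EuclideanSpace.norm_sq_eq]
  have hf : ∀ x : EuclideanSpace ℝ (Fin d),
      indicator {ξ : Fin d → ℝ | sumSq ξ < 1} (fun ξ => sumSq ξ ^ (-t)) (WithLp.ofLp x)
        = indicator (Iio (1:ℝ)) (fun r => r ^ (-(2 * t))) ‖x‖ := by
    intro x
    have : ‖x‖ ^ 2 < 1 ↔ ‖x‖ < 1 := by
      rw [sq_lt_one_iff_abs_lt_one, abs_norm]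
    simp only [indicator, mem_ofPred_eq, hsq, mem_Iio, this]
    rw [← Real.rpow_natCast, ← Real.rpow_mul (norm_nonneg x)]
    congr 2
    push_cast; ring
  simp_rw [hf]
  rw [integral_fun_norm_addHaar volume (indicator (Iio (1:ℝ)) (fun r => r ^ (-(2 * t))))]
  have hrad : ∫ y in Ioi (0:ℝ), y ^ (Module.finrank ℝ (EuclideanSpace ℝ (Fin d)) - 1) •
      indicator (Iio (1:ℝ)) (fun r => r ^ (-(2 * t))) y = 1 / (d - 2 * t) := by
    have : ∀ y ∈ Ioi (0:ℝ), y ^ (Module.finrank ℝ (EuclideanSpace ℝ (Fin d)) - 1) •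
      indicator (Iio (1:ℝ)) (fun r => r ^ (-(2 * t))) y
        = indicator (Iio (1:ℝ)) (fun r => r ^ ((d:ℝ) - 1 - 2 * t)) y := by
      intro y hy
      by_cases h : y < 1
      · simp only [finrank_euclideanSpace, Fintype.card_fin, mem_Iio, h, indicator_of_mem,
          smul_eq_mul]
        rw [← Real.rpow_natCast, ← Real.rpow_add hy, Nat.cast_sub hd]
        congr 1
        push_cast; ring
      · simp [h]
    rw [setIntegral_congr_fun measurableSet_Ioi this, setIntegral_indicator measurableSet_Iio,
      Ioi_inter_Iio, ← integral_Ioc_eq_integral_Ioo,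
      ← intervalIntegral.integral_of_le zero_le_one, integral_rpow (Or.inl (by linarith)),
      Real.one_rpow, Real.zero_rpow (by linarith), show (d:ℝ) - 1 - 2 * t + 1 = d - 2 * t by ring,
      sub_zero]
  have hvol : (d:ℝ) * volume.real (Metric.ball (0 : EuclideanSpace ℝ (Fin d)) 1)
      = sphereArea d := by
    have hG := Real.Gamma_pos_of_pos (s := (d:ℝ)/2) (by positivity)
    rw [Measure.real, EuclideanSpace.volume_ball, ENNReal.ofReal_one, one_pow, one_mul,
      Fintype.card_fin, Real.Gamma_add_one (by positivity), ENNReal.toReal_ofReal (by positivity),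
      Real.sqrt_eq_rpow, ← Real.rpow_natCast, ← Real.rpow_mul Real.pi_pos.le, sphereArea]
    rw [show (1:ℝ) / 2 * d = d / 2 by ring]
    field_simp
  rw [hrad, finrank_euclideanSpace, Fintype.card_fin, nsmul_eq_mul, smul_eq_mul, ← mul_assoc (d:ℝ), hvol]
  field_simp

/-- The ratio between the weights `Φ ^ (-d/2)` and `|ξ| ^ (-d)`. -/
noncomputable def weightRatio (ξ : Fin d → ℝ) : ℝ := (sumSq ξ / laplaceSymbol ξ) ^ ((d:ℝ)/2)

lemma laplaceSymbol_pos {ξ : Fin d → ℝ} (h : ξ ∈ puncturedTorus d) : 0 < laplaceSymbol ξ := by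
  have := sumSq_pos h.2
  have := Real.pi_pos
  exact lt_of_lt_of_le (by positivity) (mul_sumSq_le_laplaceSymbol h.1)

lemma one_le_sumSq_div {ξ : Fin d → ℝ} (h : ξ ∈ puncturedTorus d) :
    1 ≤ sumSq ξ / laplaceSymbol ξ :=
  (one_le_div (laplaceSymbol_pos h)).mpr (laplaceSymbol_le_sumSq ξ)

lemma sumSq_div_le {ξ : Fin d → ℝ} (h : ξ ∈ puncturedTorus d) :
    sumSq ξ / laplaceSymbol ξ ≤ Real.pi ^ 2 / 4 := by
  have h1 := mul_sumSq_le_laplaceSymbol h.1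
  have := Real.pi_pos
  rw [div_le_iff₀ (laplaceSymbol_pos h)]
  calc sumSq ξ = Real.pi ^ 2 / 4 * (4 / Real.pi ^ 2 * sumSq ξ) := by field_simp
    _ ≤ _ := by gcongr

lemma measurable_weightRatio : Measurable (weightRatio : (Fin d → ℝ) → ℝ) :=
  (continuous_sumSq.measurable.div continuous_laplaceSymbol.measurable).pow_const _

lemma norm_weightRatio_le {ξ : Fin d → ℝ} (h : ξ ∈ puncturedTorus d) :
    ‖weightRatio ξ‖ ≤ (Real.pi ^ 2 / 4) ^ ((d:ℝ)/2) := by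
  have h0 : 0 ≤ sumSq ξ / laplaceSymbol ξ := zero_le_one.trans (one_le_sumSq_div h)
  rw [weightRatio, Real.norm_of_nonneg (by positivity)]
  exact Real.rpow_le_rpow h0 (sumSq_div_le h) (by positivity)

lemma tendsto_weightRatio :
    Tendsto (weightRatio : (Fin d → ℝ) → ℝ) (𝓝[puncturedBall d] 0) (𝓝 1) := by
  have h0 : Tendsto (fun ξ : Fin d → ℝ => (1 - sumSq ξ)⁻¹) (𝓝[puncturedBall d] 0) (𝓝 1) := by
    have h : Tendsto (sumSq : (Fin d → ℝ) → ℝ) (𝓝[puncturedBall d] 0) (𝓝 0) := by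
      have := (continuous_sumSq (d := d)).tendsto 0
      rw [show sumSq (0 : Fin d → ℝ) = 0 by simp [sumSq]] at this
      exact this.mono_left nhdsWithin_le_nhds
    simpa using (h.const_sub 1).inv₀ (by norm_num)
  have h1 : Tendsto (fun ξ : Fin d → ℝ => sumSq ξ / laplaceSymbol ξ)
      (𝓝[puncturedBall d] 0) (𝓝 1) := by
    refine tendsto_of_tendsto_of_tendsto_of_le_of_le' tendsto_const_nhds h0 ?_ ?_
    · filter_upwards [self_mem_nhdsWithin] with ξ hξ
      exact one_le_sumSq_div (puncturedBall_subset hξ)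
    · filter_upwards [self_mem_nhdsWithin] with ξ hξ
      have h2 : 0 < 1 - sumSq ξ := sub_pos.mpr hξ.1
      rw [div_le_iff₀ (laplaceSymbol_pos (puncturedBall_subset hξ)), inv_mul_eq_div,
        le_div_iff₀ h2]
      exact sumSq_mul_one_sub_le_laplaceSymbol hξ.1
  have h2 := h1.rpow_const (p := (d:ℝ)/2) (Or.inl one_ne_zero)
  rwa [Real.one_rpow] at h2

lemma measurable_const_mul_rpow {h : (Fin d → ℝ) → ℝ} (hh : Continuous h) (c t : ℝ) :
    Measurable fun ξ => c * h ξ ^ (-t) :=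
  (hh.measurable.pow_const _).const_mul _

lemma tendsto_setIntegral_puncturedBall_laplaceSymbol (hd : 1 ≤ d) :
    Tendsto (fun t : ℝ => ∫ ξ in puncturedBall d,
      ((d:ℝ) - 2 * t) / sphereArea d * laplaceSymbol ξ ^ (-t)) (𝓝[<] ((d:ℝ)/2)) (𝓝 1) := by
  have hS := sphereArea_pos hd
  have hpeak := tendsto_setIntegral_peak_smul_of_integrableOn_of_tendsto (μ := volume)
    (s := puncturedBall d) (t := puncturedBall d) (x₀ := 0) (l := 𝓝[<] ((d:ℝ)/2))
    (φ := fun (t : ℝ) ξ => ((d:ℝ) - 2 * t) / sphereArea d * sumSq ξ ^ (-t))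
    (g := weightRatio) (a := 1) measurableSet_puncturedBall measurableSet_puncturedBall
    subset_rfl self_mem_nhdsWithin volume_puncturedBall_ne_top
    (by
      filter_upwards [eventually_pos_lt hd] with t ht ξ hξ
      have := sub_two_mul_pos ht.2
      have := sumSq_pos hξ.2
      positivity)
    (fun u hu h0 => by
      obtain ⟨c, hc, h⟩ := exists_pos_le_sumSq hu h0
      exact tendstoUniformlyOn_rpow_neg hd hc fun ξ hξ => h ξ hξ.2)
    (tendsto_const_nhds.congr' (by
      filter_upwards [self_mem_nhdsWithin] with t ht
      exact (setIntegral_rpow_sumSq hd ht).symm))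
    (Eventually.of_forall fun t =>
      (measurable_const_mul_rpow continuous_sumSq _ t).aestronglyMeasurable)
    (Measure.integrableOn_of_bounded volume_puncturedBall_ne_top
      measurable_weightRatio.aestronglyMeasurable
      ((ae_restrict_mem measurableSet_puncturedBall).mono fun ξ hξ =>
        norm_weightRatio_le (puncturedBall_subset hξ)))
    tendsto_weightRatio
  have key : ∀ᶠ t : ℝ in 𝓝[<] ((d:ℝ)/2),
      1 ≤ (∫ ξ in puncturedBall d, ((d:ℝ) - 2 * t) / sphereArea d * laplaceSymbol ξ ^ (-t)) ∧
      (∫ ξ in puncturedBall d, ((d:ℝ) - 2 * t) / sphereArea d * laplaceSymbol ξ ^ (-t)) ≤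
      ∫ ξ in puncturedBall d,
        (((d:ℝ) - 2 * t) / sphereArea d * sumSq ξ ^ (-t)) • weightRatio ξ := by
    filter_upwards [eventually_pos_lt hd] with t ht
    have ht' := sub_two_mul_pos ht.2
    have hint1 : IntegrableOn (fun ξ => ((d:ℝ) - 2 * t) / sphereArea d * sumSq ξ ^ (-t))
        (puncturedBall d) := by
      by_contra h
      have := setIntegral_rpow_sumSq hd ht.2
      rw [integral_undef h] at this
      exact zero_ne_one this
    have hint2 : IntegrableOn (fun ξ =>
        (((d:ℝ) - 2 * t) / sphereArea d * sumSq ξ ^ (-t)) • weightRatio ξ) (puncturedBall d) :=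
      hint1.mul_bdd measurable_weightRatio.aestronglyMeasurable
        ((ae_restrict_mem measurableSet_puncturedBall).mono fun ξ hξ =>
          norm_weightRatio_le (puncturedBall_subset hξ))
    have hle1 : ∀ ξ ∈ puncturedBall d, ((d:ℝ) - 2 * t) / sphereArea d * sumSq ξ ^ (-t) ≤
        ((d:ℝ) - 2 * t) / sphereArea d * laplaceSymbol ξ ^ (-t) := fun ξ hξ => by
      refine mul_le_mul_of_nonneg_left ?_ (by positivity)
      exact Real.rpow_le_rpow_of_nonpos (laplaceSymbol_pos (puncturedBall_subset hξ))
        (laplaceSymbol_le_sumSq ξ) (by linarith)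
    have hle2 : ∀ ξ ∈ puncturedBall d, ((d:ℝ) - 2 * t) / sphereArea d * laplaceSymbol ξ ^ (-t) ≤
        (((d:ℝ) - 2 * t) / sphereArea d * sumSq ξ ^ (-t)) • weightRatio ξ := fun ξ hξ => by
      have hN := sumSq_pos hξ.2
      have hP := laplaceSymbol_pos (puncturedBall_subset hξ)
      rw [smul_eq_mul, mul_assoc]
      refine mul_le_mul_of_nonneg_left ?_ (by positivity)
      calc laplaceSymbol ξ ^ (-t)
          = sumSq ξ ^ (-t) * (sumSq ξ / laplaceSymbol ξ) ^ t := by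
            rw [Real.div_rpow hN.le hP.le, Real.rpow_neg hN.le, Real.rpow_neg hP.le]
            have := Real.rpow_pos_of_pos hN t
            field_simp
        _ ≤ _ := by
            refine mul_le_mul_of_nonneg_left ?_ (by positivity)
            exact Real.rpow_le_rpow_of_exponent_le
              (one_le_sumSq_div (puncturedBall_subset hξ)) ht.2.le
    have hint3 : IntegrableOn (fun ξ => ((d:ℝ) - 2 * t) / sphereArea d * laplaceSymbol ξ ^ (-t))
        (puncturedBall d) := by
      refine Integrable.mono' hint2
        (measurable_const_mul_rpow continuous_laplaceSymbol _ t).aestronglyMeasurable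
        ((ae_restrict_mem measurableSet_puncturedBall).mono fun ξ hξ => ?_)
      have hP := laplaceSymbol_pos (puncturedBall_subset hξ)
      rw [Real.norm_of_nonneg (by positivity)]
      exact hle2 ξ hξ
    constructor
    · rw [← setIntegral_rpow_sumSq hd ht.2]
      exact setIntegral_mono_on hint1 hint3 measurableSet_puncturedBall hle1
    · exact setIntegral_mono_on hint3 hint2 measurableSet_puncturedBall hle2
  exact tendsto_of_tendsto_of_tendsto_of_le_of_le' tendsto_const_nhds hpeak
    (key.mono fun _ h => h.1) (key.mono fun _ h => h.2)

lemma tendsto_setIntegral_puncturedTorus_smul {E : Type*} [NormedAddCommGroup E]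
    [NormedSpace ℝ E] [CompleteSpace E] (hd : 1 ≤ d) {g : (Fin d → ℝ) → E} (hg : Continuous g) :
    Tendsto (fun t : ℝ => ∫ ξ in puncturedTorus d,
      (((d:ℝ) - 2 * t) / sphereArea d * laplaceSymbol ξ ^ (-t)) • g ξ)
      (𝓝[<] ((d:ℝ)/2)) (𝓝 (g 0)) := by
  have hS := sphereArea_pos hd
  refine tendsto_setIntegral_peak_smul_of_integrableOn_of_tendsto (μ := volume)
    measurableSet_puncturedTorus measurableSet_puncturedBall puncturedBall_subset
    puncturedBall_mem volume_puncturedBall_ne_top ?_ ?_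
    (tendsto_setIntegral_puncturedBall_laplaceSymbol hd) ?_ ?_ ?_
  · filter_upwards [eventually_pos_lt hd] with t ht ξ hξ
    have := sub_two_mul_pos ht.2
    have := laplaceSymbol_pos hξ
    positivity
  · intro u hu h0
    obtain ⟨c, hc, h⟩ := exists_pos_le_sumSq hu h0
    have := Real.pi_pos
    refine tendstoUniformlyOn_rpow_neg hd (c := 4 / Real.pi ^ 2 * c) (by positivity)
      fun ξ hξ => le_trans ?_ (mul_sumSq_le_laplaceSymbol hξ.1.1)
    gcongr
    exact h ξ hξ.2
  · exact Eventually.of_forall fun t =>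
      (measurable_const_mul_rpow continuous_laplaceSymbol _ t).aestronglyMeasurable
  · exact (hg.continuousOn.integrableOn_compact
      (isCompact_univ_pi fun _ => isCompact_Icc)).mono_set sdiff_subset
  · exact (hg.tendsto 0).mono_left nhdsWithin_le_nhds

end

theorem stmt17 (d : ℕ) (hd : 1 ≤ d) (k : Fin d → ℤ) (hk : k ≠ 0) :
    Filter.Tendsto
      (fun t : ℝ => ((d:ℝ) - 2*t) •
        ∫ ξ in Set.univ.pi fun _ : Fin d => Set.Icc (-Real.pi) Real.pi,
          ((((∑ j, (2 - 2 * Real.cos (ξ j))) ^ (-t) : ℝ)) : ℂ) *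
            Complex.exp (Complex.I * (((∑ j, (k j : ℝ) * ξ j : ℝ)) : ℂ)))
      (nhdsWithin ((d:ℝ)/2) (Set.Iio ((d:ℝ)/2)))
      (nhds (((2 * Real.pi ^ ((d:ℝ)/2) / Real.Gamma ((d:ℝ)/2) : ℝ)) : ℂ)) := by
  have : Nonempty (Fin d) := ⟨⟨0, hd⟩⟩
  have hS := sphereArea_pos hd
  have h := (tendsto_setIntegral_puncturedTorus_smul hd
    (g := fun ξ : Fin d → ℝ => Complex.exp (Complex.I * ((∑ j, (k j : ℝ) * ξ j : ℝ) : ℂ)))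
    (by fun_prop)).const_smul (sphereArea d)
  have hlim : sphereArea d • Complex.exp
      (Complex.I * ((∑ j, (k j : ℝ) * (0 : Fin d → ℝ) j : ℝ) : ℂ)) = (sphereArea d : ℂ) := by
    simp
  rw [hlim] at h
  refine h.congr fun t => ?_
  have hnull : puncturedTorus d =ᵐ[volume]
      (univ.pi fun _ : Fin d => Icc (-Real.pi) Real.pi : Set (Fin d → ℝ)) :=
    sdiff_null_ae_eq_self (measure_singleton 0)
  rw [setIntegral_congr_set hnull, ← integral_smul, ← integral_smul]
  congr 1
  funext ξ
  rw [smul_smul, ← mul_assoc, mul_div_cancel₀ _ hS.ne', mul_smul, Complex.real_smul (x := _ ^ _)]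
  rfl
end
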